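/- arXiv:2011.02596 — 2 statements merged into one kernel-verified Lean document; each statement's English description precedes it below -/
import Mathlib

section
/- The utility function Ǔ attains its maximum over (0, ∞) at z = z_max, and this maximizer is unique: for every z > 0 with z ≠ z_max one has Ǔ(z) < Ǔ(z_max). -/
/-- With `0 < z_min ≤ z_max`, `β = √(2 z_max² − z_min²)` and
`Ǔ(z) = (−(z−β)² − (z−z_min)²)/z` for `z ≠ 0`, the utility function `Ǔ` attains its
maximum over `(0, ∞)` at `z = z_max`, and the maximizer is unique: for every `z > 0`
with `z ≠ z_max` one has `Ǔ(z) < Ǔ(z_max)`. -/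
theorem utility_max_at_zmax (zmin zmax : ℝ) (hmin : 0 < zmin) (hle : zmin ≤ zmax)
    (β : ℝ) (hβ : β = Real.sqrt (2 * zmax ^ 2 - zmin ^ 2))
    (U : ℝ → ℝ) (hU : ∀ z : ℝ, z ≠ 0 → U z = (-(z - β) ^ 2 - (z - zmin) ^ 2) / z) :
    IsMaxOn U (Set.Ioi (0 : ℝ)) zmax ∧
      ∀ z ∈ Set.Ioi (0 : ℝ), z ≠ zmax → U z < U zmax := by
  have hm : 0 < zmax := lt_of_lt_of_le hmin hle
  have hb : β ^ 2 = 2 * zmax ^ 2 - zmin ^ 2 := by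
    rw [hβ]
    exact Real.sq_sqrt (by nlinarith)
  have key : ∀ z : ℝ, 0 < z → U z = 2 * (β + zmin) - 2 * z - 2 * zmax ^ 2 / z := by
    intro z hz
    rw [hU z hz.ne', div_eq_iff hz.ne', sub_mul, div_mul_cancel₀ _ hz.ne']
    linear_combination -hb
  have diff : ∀ z : ℝ, 0 < z → U zmax - U z = 2 * (z - zmax) ^ 2 / z := by
    intro z hz
    rw [key z hz, key zmax hm]
    field_simp
    ring
  constructor
  · intro z hz
    have hz' : 0 < z := hz
    have h : 0 ≤ 2 * (z - zmax) ^ 2 / z := by positivity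
    have h2 := diff z hz'
    show U z ≤ U zmax
    linarith
  · intro z hz hne
    have hz' : 0 < z := hz
    have h0 : z - zmax ≠ 0 := sub_ne_zero.mpr hne
    have h : 0 < 2 * (z - zmax) ^ 2 / z := by positivity
    have h2 := diff z hz'
    linarith
end

section
/- The utility function Ǔ is strictly increasing on the interval (0, z_max] and strictly decreasing on the interval [z_max, ∞). -/
/-- With `0 < z_min ≤ z_max`, `β = √(2 z_max² − z_min²)` and
`Ǔ(z) = (−(z−β)² − (z−z_min)²)/z` for `z ≠ 0`, the utility function `Ǔ` is strictly
increasing on `(0, z_max]` and strictly decreasing on `[z_max, ∞)`. -/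
theorem utility_monotonicity (zmin zmax : ℝ) (hmin : 0 < zmin) (hle : zmin ≤ zmax)
    (β : ℝ) (hβ : β = Real.sqrt (2 * zmax ^ 2 - zmin ^ 2))
    (U : ℝ → ℝ) (hU : ∀ z : ℝ, z ≠ 0 → U z = (-(z - β) ^ 2 - (z - zmin) ^ 2) / z) :
    StrictMonoOn U (Set.Ioc (0 : ℝ) zmax) ∧ StrictAntiOn U (Set.Ici zmax) := by
  have hsq : β ^ 2 = 2 * zmax ^ 2 - zmin ^ 2 := by
    rw [hβ, Real.sq_sqrt]
    nlinarith
  have key : ∀ a b : ℝ, 0 < a → 0 < b →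
      U b - U a = 2 * (b - a) * (zmax ^ 2 - a * b) / (a * b) := by
    intro a b ha hb
    rw [hU a ha.ne', hU b hb.ne', div_sub_div _ _ hb.ne' ha.ne', mul_comm b a]
    congr 1
    linear_combination (b - a) * hsq
  constructor
  · rintro a ⟨ha, ha'⟩ b ⟨hb, hb'⟩ hab
    have h1 : 0 < zmax ^ 2 - a * b := by nlinarith
    have h2 : 0 < b - a := sub_pos.mpr hab
    have h3 : 0 < U b - U a := by
      rw [key a b ha hb]
      positivity
    linarith
  · intro a ha b hb hab
    rw [Set.mem_Ici] at ha hb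
    have ha0 : 0 < a := by linarith
    have hb0 : 0 < b := by linarith
    have h1 : zmax ^ 2 - a * b < 0 := by nlinarith
    have h2 : 0 < b - a := sub_pos.mpr hab
    have h3 : U b - U a < 0 := by
      rw [key a b ha0 hb0]
      exact div_neg_of_neg_of_pos (mul_neg_of_pos_of_neg (by positivity) h1) (by positivity)
    linarith
end
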